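/- arXiv:2602.15323 — 3 statements merged into one kernel-verified Lean document; each statement's English description precedes it below -/
import Mathlib

section
/- Let n and r be natural numbers with 2·r < n, and let x, x'' : Fin n → Bool. If for every ζ : Fin n → Bool one has hammingDist x ζ ≤ r if and only if hammingDist x'' ζ ≤ r, then x = x''. -/
/-- Flipping the bits of `x` in `T` moves it to Hamming distance `#T`. -/
theorem hammingDist_xor_mem {ι : Type*} [Fintype ι] [DecidableEq ι] (x : ι → Bool)
    (T : Finset ι) : hammingDist x (fun i => xor (x i) (decide (i ∈ T))) = T.card := by
  unfold hammingDist
  congr 1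
  ext i
  by_cases hi : i ∈ T <;> simp [hi]

/-- Flipping bits of `x` at positions where `x` and `y` agree adds to the distance from `y`. -/
theorem hammingDist_xor_mem_of_eqOn {ι : Type*} [Fintype ι] [DecidableEq ι] (x y : ι → Bool)
    (T : Finset ι) (hT : ∀ i ∈ T, x i = y i) :
    hammingDist y (fun i => xor (x i) (decide (i ∈ T))) = T.card + hammingDist x y := by
  unfold hammingDist
  rw [← Finset.card_union_of_disjoint]
  · congr 1
    ext i
    by_cases hi : i ∈ T
    · simp [hi, hT i hi]
    · simp [hi, eq_comm]
  · exact Finset.disjoint_left.2 fun i hi => by simp [hT i hi]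

/-- Hamming balls of radius `r < n/2` determine their centers: if the radius-`r` ball
indicators of `x` and `x''` agree on every point, then `x = x''`. -/
theorem hamming_ball_determines_center (n r : ℕ) (hrn : 2 * r < n)
    (x x'' : Fin n → Bool)
    (hiff : ∀ ζ : Fin n → Bool, hammingDist x ζ ≤ r ↔ hammingDist x'' ζ ≤ r) :
    x = x'' := by
  have hcard : (Finset.univ.filter fun i => x i = x'' i).card + hammingDist x x'' = n := by
    simpa [hammingDist] using
      Finset.card_filter_add_card_filter_not (s := Finset.univ) (fun i => x i = x'' i)
  obtain ⟨T, hT, hTcard⟩ := Finset.exists_subset_card_eq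
    (min_le_right r (Finset.univ.filter fun i => x i = x'' i).card)
  have h := hiff fun i => xor (x i) (decide (i ∈ T))
  rw [hammingDist_xor_mem, hammingDist_xor_mem_of_eqOn x x'' T
    fun i hi => (Finset.mem_filter.1 (hT hi)).2] at h
  exact hammingDist_eq_zero.1 (by omega)
end

section
/- Let n be a natural number and let x, x'' : Fin n → Bool with x ≠ x''; set d = hammingDist x x''. For every natural number r with r + d ≤ n, there exists ζ : Fin n → Bool such that hammingDist x ζ = r and hammingDist x'' ζ = d + r. -/
/-- Separating-point construction: if `x ≠ x''` with `d = hammingDist x x''` and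
`r + d ≤ n`, there is a point at distance exactly `r` from `x` and `d + r` from `x''`. -/
theorem separating_point_exists (n : ℕ) (x x'' : Fin n → Bool) (hne : x ≠ x'')
    (r : ℕ) (hr : r + hammingDist x x'' ≤ n) :
    ∃ ζ : Fin n → Bool,
      hammingDist x ζ = r ∧ hammingDist x'' ζ = hammingDist x x'' + r := by
  have hcard : r ≤ (Finset.univ.filter fun i => ¬ x i ≠ x'' i).card := by
    have h := Finset.card_filter_add_card_filter_not (s := (Finset.univ : Finset (Fin n)))
      (fun i => x i ≠ x'' i)
    rw [Finset.card_univ, Fintype.card_fin] at h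
    unfold hammingDist at hr
    omega
  obtain ⟨S, hS, rfl⟩ := Finset.exists_subset_card_eq hcard
  have hagree : ∀ i ∈ S, x i = x'' i := fun i hi => by simpa using hS hi
  refine ⟨fun i => if i ∈ S then !x i else x i, ?_, ?_⟩
  · unfold hammingDist
    congr 1
    ext i
    by_cases hi : i ∈ S <;> simp [hi]
  · unfold hammingDist
    rw [← Finset.card_union_of_disjoint]
    · congr 1
      ext i
      by_cases hi : i ∈ S
      · simp [hi, hagree i hi]
      · simp [hi, eq_comm]
    · rw [Finset.disjoint_left]
      intro i hi hiS
      exact (Finset.mem_filter.mp hi).2 (hagree i hiS)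
end

section
/- Let n, r, K be natural numbers with r ≤ n, let V denote the type Fin n → Bool, let g : V → Fin K, and let Rec : Fin K → V → Option V be such that for all x, x' : V with hammingDist x x' = r, Rec (g x) x' = some x. Then K ≥ Nat.choose n r; in particular, any such sketch must have at least log₂(n choose r) bits. -/
/-- The Hamming distance from the indicator of a finset to the zero word is its cardinality. -/
theorem hammingDist_indicator_false {ι : Type*} [Fintype ι] [DecidableEq ι] (s : Finset ι) :
    hammingDist (fun i => decide (i ∈ s)) (fun _ => false) = s.card := by
  simp [hammingDist]

/-- Hamming sharp-sketch lower bound (perfect-correctness form): if recovery reconstructs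
`x` from its sketch `g x` and any point `x'` at Hamming distance exactly `r`, then the
number `K` of sketch values satisfies `K ≥ (n choose r)`. -/
theorem hamming_sketch_lower_bound (n r K : ℕ) (hr : r ≤ n)
    (g : (Fin n → Bool) → Fin K)
    (Rec : Fin K → (Fin n → Bool) → Option (Fin n → Bool))
    (hRec : ∀ x x' : Fin n → Bool, hammingDist x x' = r → Rec (g x) x' = some x) :
    Nat.choose n r ≤ K := by
  have recover (s : Finset (Fin n)) (hs : s.card = r) :
      Rec (g fun i => decide (i ∈ s)) (fun _ => false) = some fun i => decide (i ∈ s) :=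
    hRec _ _ ((hammingDist_indicator_false s).trans hs)
  have hcard : (Finset.powersetCard r (Finset.univ : Finset (Fin n))).card ≤
      (Finset.univ : Finset (Fin K)).card := by
    refine Finset.card_le_card_of_injOn (fun s => g fun i => decide (i ∈ s))
      (fun _ _ => Finset.mem_coe.2 (Finset.mem_univ _)) fun s hs t ht hst => ?_
    have hs' := recover s (Finset.mem_powersetCard.1 hs).2
    have ht' := recover t (Finset.mem_powersetCard.1 ht).2
    have hst' : g (fun i => decide (i ∈ s)) = g fun i => decide (i ∈ t) := hst
    rw [hst', ht', Option.some_inj] at hs'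
    ext i
    simpa using (congrFun hs' i).symm
  simpa using hcard
end
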